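/- arXiv:2009.14416 — 5 statements merged into one kernel-verified Lean document; each statement's English description precedes it below -/
import Mathlib

section
/- Let A and B be real symmetric positive definite n×n matrices all of whose eigenvalues are strictly greater than 1. Then ‖A⁻¹ − B⁻¹‖_F ≤ ‖A − B‖_F. -/
/-- Frobenius norm of a real matrix. -/
noncomputable def frobNorm {n m : ℕ} (A : Matrix (Fin n) (Fin m) ℝ) : ℝ :=
  Real.sqrt (∑ i, ∑ j, (A i j) ^ 2)

open Matrix

lemma frobNorm_eq_sqrt_trace {n m : ℕ} (X : Matrix (Fin n) (Fin m) ℝ) :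
    frobNorm X = √(Xᵀ * X).trace := by
  unfold frobNorm
  rw [Finset.sum_comm]
  simp [trace, mul_apply, sq]

lemma frobNorm_transpose {n m : ℕ} (X : Matrix (Fin n) (Fin m) ℝ) :
    frobNorm Xᵀ = frobNorm X := by
  unfold frobNorm
  rw [Finset.sum_comm]
  rfl

lemma frobNorm_neg {n m : ℕ} (X : Matrix (Fin n) (Fin m) ℝ) : frobNorm (-X) = frobNorm X := by
  simp [frobNorm]

/-- Left multiplication by a matrix `A ≥ 1` does not decrease the Frobenius norm. -/
lemma frobNorm_le_frobNorm_mul {n m : ℕ} {A : Matrix (Fin n) (Fin n) ℝ}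
    (hA : (A - 1).PosSemidef) (X : Matrix (Fin n) (Fin m) ℝ) :
    frobNorm X ≤ frobNorm (A * X) := by
  rw [frobNorm_eq_sqrt_trace, frobNorm_eq_sqrt_trace]
  apply Real.sqrt_le_sqrt
  obtain ⟨P, rfl⟩ : ∃ P, A = 1 + P := ⟨A - 1, by abel⟩
  rw [add_sub_cancel_left] at hA
  have hPt : Pᵀ = P := by simpa using hA.isHermitian.eq
  have hX : 0 ≤ (Xᵀ * P * X).trace := by
    simpa using (hA.conjTranspose_mul_mul_same X).trace_nonneg
  have hPX : 0 ≤ ((P * X)ᵀ * (P * X)).trace := by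
    simpa using (posSemidef_conjTranspose_mul_self (P * X)).trace_nonneg
  have h : ((1 + P) * X)ᵀ * ((1 + P) * X)
      = Xᵀ * X + Xᵀ * P * X + Xᵀ * P * X + (P * X)ᵀ * (P * X) := by
    simp only [transpose_mul, transpose_add, transpose_one, hPt]
    simp only [Matrix.mul_add, Matrix.add_mul, Matrix.mul_one, Matrix.one_mul, Matrix.mul_assoc]
    abel
  rw [h, trace_add, trace_add, trace_add]
  linarith

lemma Matrix.IsHermitian.posSemidef_sub_one {n : ℕ} {A : Matrix (Fin n) (Fin n) ℝ}
    (hA : A.IsHermitian) (h : ∀ i, 1 ≤ hA.eigenvalues i) : (A - 1).PosSemidef := by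
  rw [posSemidef_iff_isHermitian_and_spectrum_nonneg]
  refine ⟨hA.sub isHermitian_one, fun x hx => ?_⟩
  have hx' : x + 1 ∈ spectrum ℝ A := by
    rw [spectrum.mem_iff] at hx ⊢
    convert hx using 2
    simp only [map_add, map_one]
    abel
  rw [hA.spectrum_real_eq_range_eigenvalues] at hx'
  obtain ⟨i, hi⟩ := hx'
  have := h i
  simp only [Set.mem_ofPred_eq]
  linarith

/-- For real symmetric positive definite matrices whose eigenvalues all exceed 1,
the map to the inverse is a Frobenius-norm contraction. -/
theorem stmt3 {n : ℕ} (A B : Matrix (Fin n) (Fin n) ℝ)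
    (hA : A.PosDef) (hB : B.PosDef)
    (hAeig : ∀ i, 1 < hA.1.eigenvalues i) (hBeig : ∀ i, 1 < hB.1.eigenvalues i) :
    frobNorm (A⁻¹ - B⁻¹) ≤ frobNorm (A - B) := by
  have hA1 := hA.1.posSemidef_sub_one fun i => (hAeig i).le
  have hB1 := hB.1.posSemidef_sub_one fun i => (hBeig i).le
  have hBt : Bᵀ = B := by simpa using hB.1.eq
  have hAu : A * A⁻¹ = 1 := mul_nonsing_inv A ((isUnit_iff_isUnit_det A).1 hA.isUnit)
  have hBu : B⁻¹ * B = 1 := nonsing_inv_mul B ((isUnit_iff_isUnit_det B).1 hB.isUnit)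
  have key : A * (A⁻¹ - B⁻¹) * B = -(A - B) := by
    rw [mul_sub, sub_mul, hAu, mul_assoc A, hBu, one_mul, mul_one, neg_sub]
  calc frobNorm (A⁻¹ - B⁻¹)
      ≤ frobNorm (A * (A⁻¹ - B⁻¹)) := frobNorm_le_frobNorm_mul hA1 _
    _ = frobNorm (A * (A⁻¹ - B⁻¹))ᵀ := (frobNorm_transpose _).symm
    _ ≤ frobNorm (B * (A * (A⁻¹ - B⁻¹))ᵀ) := frobNorm_le_frobNorm_mul hB1 _
    _ = frobNorm (A * (A⁻¹ - B⁻¹) * B)ᵀ := by rw [transpose_mul _ B, hBt]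
    _ = frobNorm (A - B) := by rw [frobNorm_transpose, key, frobNorm_neg]
end

section
/- Let μ₁,…,μ_k and ν₁,…,ν_k be two orthonormal families of vectors in ℝⁿ, and let α₁,…,α_k and β₁,…,β_k be real numbers all strictly greater than 1. Define A = ∑_{j=1}^{k} α_j μ_j μ_jᵀ, B = ∑_{j=1}^{k} β_j ν_j ν_jᵀ, A⁺ = ∑_{j=1}^{k} (1/α_j) μ_j μ_jᵀ, and B⁺ = ∑_{j=1}^{k} (1/β_j) ν_j ν_jᵀ. Then ‖A⁺ − B⁺‖_F ≤ ‖A − B‖_F. -/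
open Matrix

lemma sum_sq_eq_trace {n m : ℕ} (A : Matrix (Fin n) (Fin m) ℝ) :
    ∑ i, ∑ j, (A i j) ^ 2 = trace (A * Aᵀ) := by
  simp [trace, mul_apply, sq]

lemma trace_sum_vecMulVec_mul {n k : ℕ} (μ ν : Fin k → (Fin n → ℝ)) (a b : Fin k → ℝ) :
    trace ((∑ i, a i • vecMulVec (μ i) (μ i)) * ∑ j, b j • vecMulVec (ν j) (ν j)) =
      ∑ i, ∑ j, a i * b j * (μ i ⬝ᵥ ν j) ^ 2 := by
  simp only [Finset.sum_mul_sum, trace_sum, smul_mul_smul_comm, vecMulVec_mul_vecMulVec,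
    trace_smul, trace_vecMulVec, smul_eq_mul, dotProduct_smul, sq]

/-- Bessel's inequality for the dot product. -/
lemma sum_dotProduct_sq_le {n k : ℕ} (ν : Fin k → (Fin n → ℝ))
    (hν : ∀ i j, ν i ⬝ᵥ ν j = if i = j then 1 else 0) (x : Fin n → ℝ) :
    ∑ j, (x ⬝ᵥ ν j) ^ 2 ≤ x ⬝ᵥ x := by
  have h : 0 ≤ (x - ∑ j, (x ⬝ᵥ ν j) • ν j) ⬝ᵥ (x - ∑ j, (x ⬝ᵥ ν j) • ν j) :=
    Finset.sum_nonneg fun i _ => mul_self_nonneg _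
  simp only [sub_dotProduct, dotProduct_sub, sum_dotProduct, dotProduct_sum, smul_dotProduct,
    dotProduct_smul, hν, smul_eq_mul, mul_ite, mul_one, mul_zero, Finset.sum_ite_eq',
    Finset.mem_univ, if_true, dotProduct_comm _ x, sub_self, Finset.sum_const_zero, sub_zero] at h
  simp only [sq]
  linarith

/-- The squared Frobenius distance of two spectral sums, split into a part weighted by the squared
overlaps of the two families and the two parts the families do not share. -/
lemma sum_sq_spectral_sub {n k : ℕ} (μ ν : Fin k → (Fin n → ℝ)) (a b : Fin k → ℝ)
    (hμ : ∀ i j, μ i ⬝ᵥ μ j = if i = j then 1 else 0)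
    (hν : ∀ i j, ν i ⬝ᵥ ν j = if i = j then 1 else 0) :
    ∑ r, ∑ s, (((∑ i, a i • vecMulVec (μ i) (μ i)) - ∑ j, b j • vecMulVec (ν j) (ν j)) r s) ^ 2 =
      (∑ i, ∑ j, (a i - b j) ^ 2 * (μ i ⬝ᵥ ν j) ^ 2) +
        (∑ i, a i ^ 2 * (1 - ∑ j, (μ i ⬝ᵥ ν j) ^ 2)) +
        ∑ j, b j ^ 2 * (1 - ∑ i, (ν j ⬝ᵥ μ i) ^ 2) := by
  have expand : ∑ i, ∑ j, (a i - b j) ^ 2 * (μ i ⬝ᵥ ν j) ^ 2 =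
      (∑ i, a i ^ 2 * ∑ j, (μ i ⬝ᵥ ν j) ^ 2) + (∑ j, b j ^ 2 * ∑ i, (ν j ⬝ᵥ μ i) ^ 2) -
        2 * ∑ i, ∑ j, a i * b j * (μ i ⬝ᵥ ν j) ^ 2 := by
    simp only [Finset.mul_sum]
    rw [Finset.sum_comm (f := fun j i => b j ^ 2 * (ν j ⬝ᵥ μ i) ^ 2)]
    simp only [← Finset.sum_add_distrib, ← Finset.sum_sub_distrib]
    refine Finset.sum_congr rfl fun i _ => Finset.sum_congr rfl fun j _ => ?_
    rw [dotProduct_comm (ν j)]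
    ring
  rw [sum_sq_eq_trace, expand]
  simp only [transpose_sub, transpose_sum, transpose_smul, transpose_vecMulVec]
  rw [sub_mul, mul_sub, mul_sub, trace_sub, trace_sub, trace_sub,
    trace_mul_comm (∑ j, b j • vecMulVec (ν j) (ν j)) (∑ i, a i • vecMulVec (μ i) (μ i))]
  simp only [trace_sum_vecMulVec_mul, hμ, hν, mul_sub, mul_one, Finset.sum_sub_distrib]
  simp [← sq]
  ring

lemma inv_sub_inv_sq_le {a b : ℝ} (ha : 1 < a) (hb : 1 < b) :
    (1 / a - 1 / b) ^ 2 ≤ (a - b) ^ 2 := by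
  have hab : 1 ≤ a * b := by nlinarith
  have h : 1 / a - 1 / b = (b - a) / (a * b) := by field_simp
  rw [h, div_pow, ← neg_sub a b, neg_sq]
  exact div_le_self (sq_nonneg _) (one_le_pow₀ hab)

lemma inv_sq_le_sq {a : ℝ} (ha : 1 < a) : (1 / a) ^ 2 ≤ a ^ 2 := by
  have h : 1 / a ≤ a := (div_le_self zero_le_one ha.le).trans ha.le
  gcongr


/-- Pseudoinverse contraction lemma via spectral decompositions
(the key inequality inside the proof of Theorem 3). -/
theorem stmt4 {n k : ℕ} (μ ν : Fin k → (Fin n → ℝ)) (α β : Fin k → ℝ)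
    (hμ : ∀ i j, μ i ⬝ᵥ μ j = if i = j then 1 else 0)
    (hν : ∀ i j, ν i ⬝ᵥ ν j = if i = j then 1 else 0)
    (hα : ∀ j, 1 < α j) (hβ : ∀ j, 1 < β j) :
    frobNorm ((∑ j, (1 / α j) • vecMulVec (μ j) (μ j)) -
        ∑ j, (1 / β j) • vecMulVec (ν j) (ν j)) ≤
      frobNorm ((∑ j, α j • vecMulVec (μ j) (μ j)) -
        ∑ j, β j • vecMulVec (ν j) (ν j)) := by
  refine Real.sqrt_le_sqrt ?_
  have hp : ∀ i, 0 ≤ 1 - ∑ j, (μ i ⬝ᵥ ν j) ^ 2 := fun i => by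
    simpa [hμ] using sum_dotProduct_sq_le ν hν (μ i)
  have hq : ∀ j, 0 ≤ 1 - ∑ i, (ν j ⬝ᵥ μ i) ^ 2 := fun j => by
    simpa [hν] using sum_dotProduct_sq_le μ hμ (ν j)
  rw [sum_sq_spectral_sub μ ν _ _ hμ hν, sum_sq_spectral_sub μ ν _ _ hμ hν]
  refine add_le_add (add_le_add ?_ ?_) ?_
  · exact Finset.sum_le_sum fun i _ => Finset.sum_le_sum fun j _ =>
      mul_le_mul_of_nonneg_right (inv_sub_inv_sq_le (hα i) (hβ j)) (sq_nonneg _)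
  · exact Finset.sum_le_sum fun i _ => mul_le_mul_of_nonneg_right (inv_sq_le_sq (hα i)) (hp i)
  · exact Finset.sum_le_sum fun j _ => mul_le_mul_of_nonneg_right (inv_sq_le_sq (hβ j)) (hq j)
end

section
/- Let α₁ ≥ α₂ ≥ … ≥ α_k > 1 and β₁ ≥ β₂ ≥ … ≥ β_k > 1 be real numbers, and let M be a k×k real matrix with nonnegative entries whose row sums and column sums are all at most 1. Then ∑_{s=1}^{k} ∑_{t=1}^{k} (α_s β_t − 1/(α_s β_t)) M_{s,t} ≤ ∑_{s=1}^{k} (α_s β_s − 1/(α_s β_s)). -/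
/-- Dual potentials for the assignment problem: a nonnegative cost that is antitone in each
variable and satisfies the Monge condition is dominated by a sum `u s + v t` of nonnegative
potentials, with equality on the diagonal. -/
theorem exists_dual_potentials {k : ℕ} (c : Fin k → Fin k → ℝ) (h_nonneg : ∀ s t, 0 ≤ c s t)
    (h_left : ∀ t, Antitone fun s => c s t) (h_right : ∀ s, Antitone (c s))
    (h_monge : ∀ s s' t t', s ≤ s' → t ≤ t' → c s t' + c s' t ≤ c s t + c s' t') :
    ∃ u v : Fin k → ℝ, (∀ s, 0 ≤ u s) ∧ (∀ t, 0 ≤ v t) ∧ (∀ s t, c s t ≤ u s + v t) ∧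
      ∀ s, u s + v s = c s s := by
  induction k with
  | zero => exact ⟨0, 0, by simp, by simp, fun s => s.elim0, fun s => s.elim0⟩
  | succ n ih =>
    cases n with
    | zero =>
      refine ⟨fun s => c s s, 0, fun s => h_nonneg s s, by simp, fun s t => ?_, by simp⟩
      simp [show t = s by omega]
    | succ m =>
      obtain ⟨u, v, hu, hv, huv, hd⟩ := ih (fun s t => c s.succ t.succ)
        (fun s t => h_nonneg _ _)
        (fun t _ _ h => h_left t.succ (Fin.succ_le_succ_iff.mpr h))
        (fun s _ _ h => h_right s.succ (Fin.succ_le_succ_iff.mpr h))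
        (fun s s' t t' hs ht =>
          h_monge _ _ _ _ (Fin.succ_le_succ_iff.mpr hs) (Fin.succ_le_succ_iff.mpr ht))
      have h_one : ∀ i : Fin (m + 1), (Fin.succ 0 : Fin (m + 2)) ≤ i.succ :=
        fun i => Fin.succ_le_succ_iff.mpr (Fin.zero_le i)
      have hl : c (Fin.succ 0) 0 ≤ c 0 0 := h_left 0 (Fin.zero_le _)
      have hr : c (Fin.succ 0) (Fin.succ 0) ≤ c (Fin.succ 0) 0 := h_right _ (Fin.zero_le _)
      refine ⟨Fin.cons (u 0 + (c 0 0 - c (Fin.succ 0) 0)) u,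
        Fin.cons (v 0 + (c (Fin.succ 0) 0 - c (Fin.succ 0) (Fin.succ 0))) v, ?_, ?_, ?_, ?_⟩
      · refine Fin.cases ?_ fun s => ?_
        · simp only [Fin.cons_zero]
          linarith [hu 0]
        · simpa only [Fin.cons_succ] using hu s
      · refine Fin.cases ?_ fun t => ?_
        · simp only [Fin.cons_zero]
          linarith [hv 0]
        · simpa only [Fin.cons_succ] using hv t
      · refine Fin.cases (Fin.cases ?_ fun t => ?_) fun s => Fin.cases ?_ fun t => ?_
        · simp only [Fin.cons_zero]
          linarith [hd 0]
        · simp only [Fin.cons_zero, Fin.cons_succ]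
          linarith [huv 0 t, h_monge 0 (Fin.succ 0) 0 t.succ (Fin.zero_le _) (Fin.zero_le _)]
        · simp only [Fin.cons_zero, Fin.cons_succ]
          linarith [huv s 0, h_monge (Fin.succ 0) s.succ 0 (Fin.succ 0) (h_one s) (Fin.zero_le _)]
        · simpa only [Fin.cons_succ] using huv s t
      · refine Fin.cases ?_ fun s => ?_
        · simp only [Fin.cons_zero]
          linarith [hd 0]
        · simpa only [Fin.cons_succ] using hd s

/-- Weak duality for the assignment problem: a doubly substochastic weighting of a cost dominated
by nonnegative potentials `u s + v t` has total at most the sum of the potentials. -/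
theorem sum_mul_le_of_le_add {ι : Type*} [Fintype ι] {c : ι → ι → ℝ} {u v : ι → ℝ}
    (hu : ∀ s, 0 ≤ u s) (hv : ∀ t, 0 ≤ v t) (huv : ∀ s t, c s t ≤ u s + v t)
    {M : Matrix ι ι ℝ} (hM : ∀ s t, 0 ≤ M s t)
    (hrow : ∀ s, ∑ t, M s t ≤ 1) (hcol : ∀ t, ∑ s, M s t ≤ 1) :
    ∑ s, ∑ t, c s t * M s t ≤ ∑ s, (u s + v s) :=
  calc ∑ s, ∑ t, c s t * M s t
      ≤ ∑ s, ∑ t, (u s + v t) * M s t :=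
        Finset.sum_le_sum fun s _ => Finset.sum_le_sum fun t _ =>
          mul_le_mul_of_nonneg_right (huv s t) (hM s t)
    _ = ∑ s, u s * ∑ t, M s t + ∑ t, v t * ∑ s, M s t := by
        simp only [add_mul, Finset.sum_add_distrib, Finset.mul_sum]
        rw [Finset.sum_comm (f := fun s t => v t * M s t)]
    _ ≤ ∑ s, u s + ∑ t, v t :=
        add_le_add
          (Finset.sum_le_sum fun s _ => mul_le_of_le_one_right (hu s) (hrow s))
          (Finset.sum_le_sum fun t _ => mul_le_of_le_one_right (hv t) (hcol t))
    _ = ∑ s, (u s + v s) := Finset.sum_add_distrib.symm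

/-- The function `x ↦ x - 1 / x` is monotone on the positive reals. -/
theorem sub_one_div_le_sub_one_div {x y : ℝ} (hx : 0 < x) (hxy : x ≤ y) :
    x - 1 / x ≤ y - 1 / y :=
  sub_le_sub hxy (one_div_le_one_div_of_le hx hxy)

/-- The Monge condition for the cost `a * b - 1 / (a * b)` on `[1, ∞) × [1, ∞)`. -/
theorem mul_sub_one_div_mul_monge {a a' b b' : ℝ} (ha' : 1 ≤ a') (hb' : 1 ≤ b')
    (ha : a' ≤ a) (hb : b' ≤ b) :
    (a * b' - 1 / (a * b')) + (a' * b - 1 / (a' * b)) ≤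
      (a * b - 1 / (a * b)) + (a' * b' - 1 / (a' * b')) := by
  have ha₁ : 1 ≤ a := ha'.trans ha
  have hb₁ : 1 ≤ b := hb'.trans hb
  have h_prod : 1 ≤ a * a' * (b * b') :=
    one_le_mul_of_one_le_of_one_le (one_le_mul_of_one_le_of_one_le ha₁ ha')
      (one_le_mul_of_one_le_of_one_le hb₁ hb')
  have h_inv : 1 / (a * b) + 1 / (a' * b') - 1 / (a * b') - 1 / (a' * b) =
      (a - a') * (b - b') / (a * a' * (b * b')) := by
    have : a ≠ 0 := by positivity
    have : a' ≠ 0 := by positivity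
    have : b ≠ 0 := by positivity
    have : b' ≠ 0 := by positivity
    field_simp
    ring
  have h_le : (a - a') * (b - b') / (a * a' * (b * b')) ≤ (a - a') * (b - b') :=
    div_le_self (mul_nonneg (sub_nonneg.mpr ha) (sub_nonneg.mpr hb)) h_prod
  linarith

/-- The assignment inequality: among doubly substochastic weightings of the cost
A(s,t) = α_s β_t − 1/(α_s β_t), the diagonal assignment is optimal when both
eigenvalue sequences are sorted decreasingly and exceed 1. -/
theorem stmt7 {k : ℕ} (α β : Fin k → ℝ) (hαm : Antitone α) (hβm : Antitone β)
    (hα : ∀ i, 1 < α i) (hβ : ∀ i, 1 < β i)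
    (M : Matrix (Fin k) (Fin k) ℝ) (hM : ∀ s t, 0 ≤ M s t)
    (hrow : ∀ s, ∑ t, M s t ≤ 1) (hcol : ∀ t, ∑ s, M s t ≤ 1) :
    ∑ s, ∑ t, (α s * β t - 1 / (α s * β t)) * M s t ≤
      ∑ s, (α s * β s - 1 / (α s * β s)) := by
  have hα₀ : ∀ i, 0 < α i := fun i => zero_lt_one.trans (hα i)
  have hβ₀ : ∀ i, 0 < β i := fun i => zero_lt_one.trans (hβ i)
  obtain ⟨u, v, hu, hv, huv, hd⟩ :=
    exists_dual_potentials (fun s t => α s * β t - 1 / (α s * β t))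
      (fun s t => by
        simpa using sub_one_div_le_sub_one_div zero_lt_one
          (one_le_mul_of_one_le_of_one_le (hα s).le (hβ t).le))
      (fun t s s' h => sub_one_div_le_sub_one_div (mul_pos (hα₀ s') (hβ₀ t))
        (mul_le_mul_of_nonneg_right (hαm h) (hβ₀ t).le))
      (fun s t t' h => sub_one_div_le_sub_one_div (mul_pos (hα₀ s) (hβ₀ t'))
        (mul_le_mul_of_nonneg_left (hβm h) (hα₀ s).le))
      (fun s s' t t' hs ht =>
        mul_sub_one_div_mul_monge (hα s').le (hβ t').le (hαm hs) (hβm ht))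
  calc _ ≤ ∑ s, (u s + v s) := sum_mul_le_of_le_add hu hv huv hM hrow hcol
    _ = _ := Finset.sum_congr rfl fun s _ => hd s
end

section
/- Let μ₁,…,μ_k and ν₁,…,ν_k be two orthonormal families of vectors in ℝⁿ, and let α₁ ≥ … ≥ α_k > 1 and β₁ ≥ … ≥ β_k > 1 be real numbers. Define A = ∑_j α_j μ_j μ_jᵀ, B = ∑_j β_j ν_j ν_jᵀ, A⁺ = ∑_j (1/α_j) μ_j μ_jᵀ, B⁺ = ∑_j (1/β_j) ν_j ν_jᵀ. Then ‖A⁺ − B⁺‖_F² − ‖A − B‖_F² ≤ ∑_{j=1}^{k} ((1/α_j − 1/β_j)² − (α_j − β_j)²). -/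
open Matrix

/-- Bessel's inequality for the dot product. -/
theorem sum_dotProduct_sq_le_s10 {ι κ : Type*} [Fintype ι] [Fintype κ] [DecidableEq κ]
    (v : κ → ι → ℝ) (hv : ∀ i j, v i ⬝ᵥ v j = if i = j then 1 else 0) (x : ι → ℝ) :
    ∑ t, (x ⬝ᵥ v t) ^ 2 ≤ x ⬝ᵥ x := by
  have h : 0 ≤ (x - ∑ t, (x ⬝ᵥ v t) • v t) ⬝ᵥ (x - ∑ t, (x ⬝ᵥ v t) • v t) :=
    Finset.sum_nonneg fun i _ => mul_self_nonneg _
  have e : (x - ∑ t, (x ⬝ᵥ v t) • v t) ⬝ᵥ (x - ∑ t, (x ⬝ᵥ v t) • v t)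
      = x ⬝ᵥ x - ∑ t, (x ⬝ᵥ v t) ^ 2 := by
    simp only [sub_dotProduct, dotProduct_sub, sum_dotProduct, dotProduct_sum, smul_dotProduct,
      dotProduct_smul, hv, smul_eq_mul, mul_ite, mul_one, mul_zero, Finset.sum_ite_eq',
      Finset.mem_univ, if_true, dotProduct_comm _ x, ← sq, sub_self,
      Finset.sum_const_zero, sub_zero]
  linarith

/-- The Frobenius inner product of two weighted sums of rank-one projections. -/
theorem sum_mul_sum_smul_vecMulVec {ι κ : Type*} [Fintype ι] [Fintype κ]
    (μ ν : κ → ι → ℝ) (a b : κ → ℝ) :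
    ∑ i, ∑ j, (∑ s, a s • vecMulVec (μ s) (μ s)) i j * (∑ t, b t • vecMulVec (ν t) (ν t)) i j
      = ∑ s, ∑ t, a s * b t * (μ s ⬝ᵥ ν t) ^ 2 := by
  have h (s t : κ) : a s * b t * (μ s ⬝ᵥ ν t) ^ 2
      = ∑ i, ∑ j, (a s * (μ s i * μ s j)) * (b t * (ν t i * ν t j)) := by
    rw [dotProduct, sq, Finset.sum_mul_sum]
    simp only [Finset.mul_sum]
    exact Finset.sum_congr rfl fun i _ => Finset.sum_congr rfl fun j _ => by ring
  simp only [Matrix.sum_apply, Matrix.smul_apply, vecMulVec_apply, smul_eq_mul,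
    Finset.sum_mul_sum, h]
  exact (Finset.sum_congr rfl fun i _ => Finset.sum_comm).trans (Finset.sum_comm.trans
    (Finset.sum_congr rfl fun s _ =>
      (Finset.sum_congr rfl fun i _ => Finset.sum_comm).trans Finset.sum_comm))

/-- The squared Frobenius distance between two matrices given by orthonormal eigenvectors. -/
theorem frobNorm_sub_sq {n k : ℕ} (μ ν : Fin k → (Fin n → ℝ)) (a b : Fin k → ℝ)
    (hμ : ∀ i j, μ i ⬝ᵥ μ j = if i = j then 1 else 0)
    (hν : ∀ i j, ν i ⬝ᵥ ν j = if i = j then 1 else 0) :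
    (frobNorm ((∑ j, a j • vecMulVec (μ j) (μ j)) - ∑ j, b j • vecMulVec (ν j) (ν j))) ^ 2
      = ∑ j, a j ^ 2 + ∑ j, b j ^ 2 - 2 * ∑ s, ∑ t, a s * b t * (μ s ⬝ᵥ ν t) ^ 2 := by
  have haa := sum_mul_sum_smul_vecMulVec μ μ a a
  have hbb := sum_mul_sum_smul_vecMulVec ν ν b b
  simp only [hμ, ite_pow, one_pow, ne_eq, OfNat.ofNat_ne_zero, not_false_eq_true, zero_pow,
    mul_ite, mul_one, mul_zero, Finset.sum_ite_eq, Finset.mem_univ, if_true, ← sq] at haa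
  simp only [hν, ite_pow, one_pow, ne_eq, OfNat.ofNat_ne_zero, not_false_eq_true, zero_pow,
    mul_ite, mul_one, mul_zero, Finset.sum_ite_eq, Finset.mem_univ, if_true, ← sq] at hbb
  unfold frobNorm
  rw [Real.sq_sqrt (by positivity), ← sum_mul_sum_smul_vecMulVec, ← haa, ← hbb]
  simp only [Matrix.sub_apply]
  simp only [Finset.mul_sum, ← Finset.sum_add_distrib, ← Finset.sum_sub_distrib]
  refine Finset.sum_congr rfl fun i _ => Finset.sum_congr rfl fun j _ => ?_
  ring

/-- A supermodular cost admits a potential for which the diagonal is optimal. -/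
theorem exists_potential_of_supermodular (c : ℕ → ℕ → ℝ)
    (hc : ∀ s s' t t', s ≤ s' → t ≤ t' → c s t' + c s' t ≤ c s t + c s' t')
    (hanti : ∀ s, Antitone (c s)) :
    ∃ V : ℕ → ℝ, Antitone V ∧ ∀ s t, c s t - V t ≤ c s s - V s := by
  let V : ℕ → ℝ := fun t => -∑ r ∈ Finset.range t, (c (r + 1) r - c (r + 1) (r + 1))
  have hV (t : ℕ) : V (t + 1) = V t - (c (t + 1) t - c (t + 1) (t + 1)) := by
    simp only [V, Finset.sum_range_succ]
    ring
  refine ⟨V, antitone_nat_of_succ_le fun t => ?_, fun s t => ?_⟩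
  · linarith [hV t, hanti (t + 1) t.le_succ]
  · rcases le_total s t with h | h
    · induction t, h using Nat.le_induction with
      | base => rfl
      | succ t hst ih => linarith [hV t, hc s (t + 1) t (t + 1) (by omega) t.le_succ]
    · induction h using Nat.decreasingInduction with
      | self => rfl
      | of_succ t hts ih => linarith [hV t, hc (t + 1) s t (t + 1) hts t.le_succ]

/-- The diagonal assignment is optimal among doubly substochastic matrices for a nonnegative
supermodular cost. -/
theorem sum_mul_le_sum_diag_of_supermodular {k : ℕ} (c : ℕ → ℕ → ℝ) (M : Fin k → Fin k → ℝ)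
    (hc : ∀ s s' t t', s ≤ s' → t ≤ t' → c s t' + c s' t ≤ c s t + c s' t')
    (hanti : ∀ s, Antitone (c s)) (hc0 : ∀ s t, 0 ≤ c s t)
    (hM : ∀ s t, 0 ≤ M s t) (hrow : ∀ s, ∑ t, M s t ≤ 1) (hcol : ∀ t, ∑ s, M s t ≤ 1) :
    ∑ s : Fin k, ∑ t : Fin k, c s t * M s t ≤ ∑ j : Fin k, c j j := by
  obtain ⟨V, hVanti, hV⟩ := exists_potential_of_supermodular c hc hanti
  calc ∑ s : Fin k, ∑ t : Fin k, c s t * M s t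
      ≤ ∑ s : Fin k, ∑ t : Fin k, ((c s s - V s + V k) * M s t + (V t - V k) * M s t) := by
        refine Finset.sum_le_sum fun s _ => Finset.sum_le_sum fun t _ => ?_
        rw [← add_mul]
        exact mul_le_mul_of_nonneg_right (by linarith [hV s t]) (hM s t)
    _ = ∑ s : Fin k, (c s s - V s + V k) * ∑ t, M s t
        + ∑ t : Fin k, (V t - V k) * ∑ s, M s t := by
        simp only [Finset.sum_add_distrib, Finset.mul_sum]
        congr 1
        exact Finset.sum_comm
    _ ≤ ∑ s : Fin k, (c s s - V s + V k) + ∑ t : Fin k, (V t - V k) := by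
        refine add_le_add (Finset.sum_le_sum fun s _ => ?_) (Finset.sum_le_sum fun t _ => ?_)
        · exact mul_le_of_le_one_right (by linarith [hV s k, hc0 s k]) (hrow s)
        · exact mul_le_of_le_one_right (sub_nonneg.2 (hVanti t.is_lt.le)) (hcol t)
    _ = ∑ j : Fin k, c j j := by
        rw [← Finset.sum_add_distrib]
        exact Finset.sum_congr rfl fun j _ => by ring

/-- The function `x * y - 1 / (x * y)` is supermodular on `[1, ∞)²`. -/
theorem mul_sub_one_div_supermodular {x x' y y' : ℝ} (hx' : 1 ≤ x') (hy' : 1 ≤ y')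
    (hx : x' ≤ x) (hy : y' ≤ y) :
    (x * y' - 1 / x * (1 / y')) + (x' * y - 1 / x' * (1 / y))
      ≤ (x * y - 1 / x * (1 / y)) + (x' * y' - 1 / x' * (1 / y')) := by
  have hx0 : 0 < x' := by linarith
  have hy0 : 0 < y' := by linarith
  have hx1 : 1 ≤ x := hx'.trans hx
  have hy1 : 1 ≤ y := hy'.trans hy
  have hx2 : 0 < x := by linarith
  have hy2 : 0 < y := by linarith
  have hprod : 1 ≤ (x * x') * (y * y') :=
    one_le_mul_of_one_le_of_one_le (one_le_mul_of_one_le_of_one_le hx1 hx')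
      (one_le_mul_of_one_le_of_one_le hy1 hy')
  have hinv : 1 / ((x * x') * (y * y')) ≤ 1 := (div_le_one (by positivity)).2 hprod
  have hnn := mul_nonneg (mul_nonneg (sub_nonneg.2 hx) (sub_nonneg.2 hy)) (sub_nonneg.2 hinv)
  have e : (x - x') * (y - y') * (1 - 1 / ((x * x') * (y * y')))
      = (x * y - 1 / x * (1 / y)) + (x' * y' - 1 / x' * (1 / y'))
        - ((x * y' - 1 / x * (1 / y')) + (x' * y - 1 / x' * (1 / y))) := by
    field_simp
    ring
  linarith

/-- Extension of a finite sequence to `ℕ` by the value `1`. -/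
noncomputable def extendOne {k : ℕ} (a : Fin k → ℝ) (i : ℕ) : ℝ :=
  if h : i < k then a ⟨i, h⟩ else 1

theorem extendOne_val {k : ℕ} (a : Fin k → ℝ) (i : Fin k) : extendOne a i = a i := by
  simp [extendOne]

theorem one_le_extendOne {k : ℕ} {a : Fin k → ℝ} (ha : ∀ j, 1 < a j) (i : ℕ) :
    1 ≤ extendOne a i := by
  unfold extendOne
  split_ifs with h
  · exact (ha _).le
  · exact le_rfl

theorem antitone_extendOne {k : ℕ} {a : Fin k → ℝ} (ham : Antitone a) (ha : ∀ j, 1 < a j) :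
    Antitone (extendOne a) := by
  intro i j hij
  by_cases hj : j < k
  · have hi : i < k := hij.trans_lt hj
    simpa [extendOne, hi, hj] using ham (show (⟨i, hi⟩ : Fin k) ≤ ⟨j, hj⟩ from hij)
  · have : extendOne a j = 1 := by simp [extendOne, hj]
    exact this ▸ one_le_extendOne ha i

/-- The penultimate bound in the proof of Theorem 3. -/
theorem stmt10 {n k : ℕ} (μ ν : Fin k → (Fin n → ℝ)) (α β : Fin k → ℝ)
    (hμ : ∀ i j, μ i ⬝ᵥ μ j = if i = j then 1 else 0)
    (hν : ∀ i j, ν i ⬝ᵥ ν j = if i = j then 1 else 0)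
    (hαm : Antitone α) (hβm : Antitone β)
    (hα : ∀ j, 1 < α j) (hβ : ∀ j, 1 < β j) :
    (frobNorm ((∑ j, (1 / α j) • vecMulVec (μ j) (μ j)) -
        ∑ j, (1 / β j) • vecMulVec (ν j) (ν j))) ^ 2 -
      (frobNorm ((∑ j, α j • vecMulVec (μ j) (μ j)) -
        ∑ j, β j • vecMulVec (ν j) (ν j))) ^ 2 ≤
      ∑ j, ((1 / α j - 1 / β j) ^ 2 - (α j - β j) ^ 2) := by
  rw [frobNorm_sub_sq μ ν _ _ hμ hν, frobNorm_sub_sq μ ν _ _ hμ hν]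
  have hA := one_le_extendOne hα
  have hB := one_le_extendOne hβ
  have hAm := antitone_extendOne hαm hα
  have hBm := antitone_extendOne hβm hβ
  have key := sum_mul_le_sum_diag_of_supermodular
    (fun s t => extendOne α s * extendOne β t - 1 / extendOne α s * (1 / extendOne β t))
    (fun s t => (μ s ⬝ᵥ ν t) ^ 2)
    (fun s s' t t' hs ht => mul_sub_one_div_supermodular (hA s') (hB t') (hAm hs) (hBm ht))
    (fun s t t' ht => by
      have h0 : 0 < extendOne α s := by linarith [hA s]
      have h1 : 0 < extendOne β t' := by linarith [hB t']
      have h2 := hBm ht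
      dsimp only
      gcongr)
    (fun s t => by
      have h0 := hA s
      have h1 := hB t
      have h2 : 1 / extendOne α s ≤ 1 := (div_le_one (by linarith)).2 h0
      have h3 : 1 / extendOne β t ≤ 1 := (div_le_one (by linarith)).2 h1
      have h4 : 0 ≤ 1 / extendOne β t := by positivity
      exact sub_nonneg.2 ((mul_le_one₀ h2 h4 h3).trans (one_le_mul_of_one_le_of_one_le h0 h1)))
    (fun s t => sq_nonneg _)
    (fun s => (sum_dotProduct_sq_le_s10 ν hν (μ s)).trans (by simp [hμ]))
    (fun t => by
      simp only [dotProduct_comm _ (ν t)]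
      exact (sum_dotProduct_sq_le_s10 μ hμ (ν t)).trans (by simp [hν]))
  simp only [extendOne_val, sub_mul, Finset.sum_sub_distrib] at key
  simp only [sub_sq, Finset.sum_sub_distrib, Finset.sum_add_distrib, mul_assoc,
    ← Finset.mul_sum] at key ⊢
  linarith
end

section
/- Let n be a positive integer, e ≥ 0, and for i = 1,…,n let x_S^i, d_S^i ∈ ℝ^{d_S} and x_T^i, d_T^i ∈ ℝ^{d_T} with ‖x_S^i‖ ≤ e and ‖x_T^i‖ ≤ e for all i. Define the n×n matrices K_S and K_T by (K_S)_{i,j} = ⟨x_S^i, x_S^j⟩ and (K_T)_{i,j} = ⟨x_T^i, x_T^j⟩. Then ‖K_S − K_T‖_F ≤ n e ∑_{i=1}^{n} ‖x_S^i − d_S^i‖ + n e ∑_{i=1}^{n} ‖x_T^i − d_T^i‖ + ∑_{i=1}^{n} ∑_{j=1}^{n} |⟨d_S^i, x_S^j⟩ − ⟨d_T^i, x_T^j⟩|. -/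
open scoped RealInnerProductSpace

theorem frobNorm_le_sum_abs {n m : ℕ} (A : Matrix (Fin n) (Fin m) ℝ) :
    frobNorm A ≤ ∑ i, ∑ j, |A i j| := by
  refine Real.sqrt_le_iff.2
    ⟨Finset.sum_nonneg fun i _ => Finset.sum_nonneg fun j _ => abs_nonneg _, ?_⟩
  calc ∑ i, ∑ j, A i j ^ 2 = ∑ i, ∑ j, |A i j| ^ 2 := by simp only [sq_abs]
    _ ≤ ∑ i, (∑ j, |A i j|) ^ 2 := Finset.sum_le_sum fun i _ =>
        Finset.sum_sq_le_sq_sum_of_nonneg fun j _ => abs_nonneg _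
    _ ≤ (∑ i, ∑ j, |A i j|) ^ 2 := Finset.sum_sq_le_sq_sum_of_nonneg fun i _ =>
        Finset.sum_nonneg fun j _ => abs_nonneg _

/-- Replacing the first arguments of two inner products by landmarks costs at most the distances
to the landmarks times a bound on the second arguments. -/
theorem abs_inner_sub_inner_le {E F : Type*} [NormedAddCommGroup E] [InnerProductSpace ℝ E]
    [NormedAddCommGroup F] [InnerProductSpace ℝ F] {e : ℝ} (x d : E) (x' d' : F) {y : E} {y' : F}
    (hy : ‖y‖ ≤ e) (hy' : ‖y'‖ ≤ e) :
    |⟪x, y⟫ - ⟪x', y'⟫| ≤ e * ‖x - d‖ + e * ‖x' - d'‖ + |⟪d, y⟫ - ⟪d', y'⟫| := by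
  have h : |⟪x - d, y⟫| ≤ e * ‖x - d‖ := by
    rw [mul_comm]
    exact (abs_real_inner_le_norm _ _).trans (by gcongr)
  have h' : |⟪x' - d', y'⟫| ≤ e * ‖x' - d'‖ := by
    rw [mul_comm]
    exact (abs_real_inner_le_norm _ _).trans (by gcongr)
  rw [inner_sub_left] at h h'
  grind

/-- Theorem 5 of the paper: the distance between the full Gram matrices of the
student and teacher is bounded via the landmark points. -/
theorem stmt13 {dS dT : ℕ} {n : ℕ} (hn : 0 < n)
    (xS dS' : Fin n → EuclideanSpace ℝ (Fin dS))
    (xT dT' : Fin n → EuclideanSpace ℝ (Fin dT))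
    (e : ℝ) (he : 0 ≤ e)
    (hS : ∀ i, ‖xS i‖ ≤ e) (hT : ∀ i, ‖xT i‖ ≤ e)
    (KS KT : Matrix (Fin n) (Fin n) ℝ)
    (hKS : ∀ i j, KS i j = ⟪xS i, xS j⟫)
    (hKT : ∀ i j, KT i j = ⟪xT i, xT j⟫) :
    frobNorm (KS - KT) ≤
      n * e * ∑ i, ‖xS i - dS' i‖ + n * e * ∑ i, ‖xT i - dT' i‖ +
        ∑ i, ∑ j, |⟪dS' i, xS j⟫ - ⟪dT' i, xT j⟫| := by
  calc frobNorm (KS - KT) ≤ ∑ i, ∑ j, |(KS - KT) i j| := frobNorm_le_sum_abs _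
    _ ≤ ∑ i, ∑ j : Fin n, (e * ‖xS i - dS' i‖ + e * ‖xT i - dT' i‖ +
          |⟪dS' i, xS j⟫ - ⟪dT' i, xT j⟫|) := by
        refine Finset.sum_le_sum fun i _ => Finset.sum_le_sum fun j _ => ?_
        rw [Matrix.sub_apply, hKS, hKT]
        exact abs_inner_sub_inner_le _ _ _ _ (hS j) (hT j)
    _ = _ := by
        simp [Finset.sum_add_distrib, Finset.mul_sum, mul_assoc]
end
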